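/- arXiv:1703.05655 — 3 statements merged into one kernel-verified Lean document; each statement's English description precedes it below -/
import Mathlib

section
/- Let T be a rooted chain complete tree satisfying condition (*), endowed with the coarse wedge topology, let A ∈ 𝒜(T), and let D = {t ∈ T : cf(t) ≤ ω}. Then the subspace cl(A) ∩ D of T is a metrizable compact space. -/
open Cardinal Ordinal Filter Set Topology

universe u v

section TreeDefs

variable {T : Type u} [PartialOrder T]

/-- `T` is a tree: the set of strict predecessors of every point is well-ordered by `<`. -/
def IsTreeOrder (T : Type u) [PartialOrder T] : Prop :=
  ∀ x : T, IsWellOrder {y : T // y < x} (· < ·)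

/-- Every chain has a supremum. -/
def ChainComplete (T : Type u) [PartialOrder T] : Prop :=
  ∀ c : Set T, IsChain (· ≤ ·) c → ∃ s, IsLUB c s

open Classical in
/-- The height `ht(x,T)` of `x`: the order type of the set of its strict predecessors. -/
noncomputable def htx (x : T) : Ordinal.{u} :=
  if h : IsWellOrder {y : T // y < x} (· < ·) then @Ordinal.type {y : T // y < x} (· < ·) h
  else 0

/-- The cofinality `cf(x)` of `ht(x,T)`. -/
noncomputable def cfx (x : T) : Cardinal.{u} := (htx x).cof

/-- `x` lies on a successor level. -/
def SuccLevel (x : T) : Prop := ∃ β : Ordinal, htx x = β + 1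

/-- The set of immediate successors of `x`. -/
def ims (x : T) : Set T := {y | x < y ∧ htx y = htx x + 1}

/-- The wedge `V_t = {s : t ≤ s}`. -/
def Vset (t : T) : Set T := {s | t ≤ s}

/-- Condition (*): every `t` with `cf(t) ≥ ω₁` has finitely many immediate successors. -/
def StarCond (T : Type u) [PartialOrder T] : Prop :=
  ∀ t : T, Cardinal.aleph 1 ≤ cfx t → (ims t).Finite

/-- The coarse wedge topology: generated by the sets `V_t` and their complements,
for `t` minimal or on a successor level. -/
def coarseWedge (T : Type u) [PartialOrder T] : TopologicalSpace T :=
  TopologicalSpace.generateFrom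
    {U : Set T | ∃ t : T, (IsMin t ∨ SuccLevel t) ∧ (U = Vset t ∨ U = (Vset t)ᶜ)}

open Classical in
/-- `s ∧ t = max (ŝ ∩ t̂)`, the largest common predecessor (when it exists). -/
noncomputable def wedge (s t : T) : T :=
  if h : ∃ m, IsGreatest {r : T | r ≤ s ∧ r ≤ t} m then h.choose else s

open Classical in
/-- `ψ(t) = ims(t)` if `cf(t) ≥ ω₁`, and `ψ(t) = {0}` (the root) otherwise. -/
noncomputable def psiSet (root : T) (t : T) : Set T :=
  if Cardinal.aleph 1 ≤ cfx t then ims t else {root}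

/-- `φ` is a choice function assigning to every `t` with `cf(t) = ω` a sequence of
successor-level elements strictly below `t` converging to `t`, and the constant
sequence at the root otherwise. -/
def PhiSpec [TopologicalSpace T] (root : T) (φ : T → ℕ → T) : Prop :=
  ∀ t : T,
    (cfx t ≠ Cardinal.aleph0 → ∀ n, φ t n = root) ∧
    (cfx t = Cardinal.aleph0 →
      (∀ n, φ t n < t ∧ SuccLevel (φ t n)) ∧ Tendsto (φ t) atTop (nhds t))

/-- Membership in the family `𝒜(T)`: countable subsets containing the root, closed
under `∧`, `φ` and `ψ`. -/
structure Admissible (root : T) (φ : T → ℕ → T) (A : Set T) : Prop where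
  countable : A.Countable
  root_mem : root ∈ A
  wedge_mem : ∀ s ∈ A, ∀ t ∈ A, wedge s t ∈ A
  phi_mem : ∀ t ∈ A, ∀ n, φ t n ∈ A
  psi_mem : ∀ t ∈ A, psiSet root t ⊆ A

/-- The height of the tree `T`: the least `α` such that the level `α` of `T` is empty. -/
noncomputable def treeHeight (T : Type u) [PartialOrder T] : Ordinal.{u} :=
  sInf {α : Ordinal | ∀ x : T, htx x ≠ α}

end TreeDefs

/-- A retractional skeleton on a compact space `K`: a family of continuous retractions
with metrizable compact ranges, indexed by an up-directed partially ordered set,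
commuting under the order, continuous under countable increasing suprema, and
converging pointwise to the identity. -/
structure RetractionalSkeleton (K : Type v) [TopologicalSpace K] where
  Γ : Type v
  [po : PartialOrder Γ]
  [ne : Nonempty Γ]
  directed : ∀ s t : Γ, ∃ u, s ≤ u ∧ t ≤ u
  r : Γ → K → K
  cont : ∀ s, Continuous (r s)
  retraction : ∀ s x, r s (r s x) = r s x
  compact_range : ∀ s, IsCompact (Set.range (r s))
  metrizable_range : ∀ s, TopologicalSpace.MetrizableSpace (Set.range (r s))
  comm : ∀ s t : Γ, s ≤ t → ∀ x, r s (r t x) = r s x ∧ r t (r s x) = r s x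
  seq_sup : ∀ s : ℕ → Γ, Monotone s → ∃ t : Γ, IsLUB (Set.range s) t ∧
      ∀ x, Tendsto (fun n => r (s n) x) atTop (nhds (r t x))
  net_conv : ∀ x : K, Tendsto (fun s : Γ => r s x) atTop (nhds x)

/-- The subset induced by a retractional skeleton: `D = ⋃ₛ rₛ[K]`. -/
def RetractionalSkeleton.inducedSet {K : Type v} [TopologicalSpace K]
    (R : RetractionalSkeleton K) : Set K :=
  ⋃ s : R.Γ, Set.range (R.r s)

/-- `A` is a `Σ`-subset of `K`: for some homeomorphic injection `h` of `K` into a cube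
`[0,1]^Γ`, `h(A) = h(K) ∩ Σ(Γ)`. -/
def IsSigmaSubset {K : Type v} [TopologicalSpace K] (A : Set K) : Prop :=
  ∃ (Γ : Type v) (h : K → Γ → Set.Icc (0 : ℝ) 1),
    Topology.IsEmbedding h ∧
      h '' A = Set.range h ∩ {x | {γ | (x γ : ℝ) ≠ 0}.Countable}

/-- `K` is a Valdivia compact space: it has a dense `Σ`-subset. -/
def IsValdivia (K : Type v) [TopologicalSpace K] : Prop :=
  ∃ A : Set K, Dense A ∧ IsSigmaSubset A

/-- The bounded topology on a product `∏_{α<ω₁} X_α`: basic open sets are the sets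
`V(g,β) = {f : f↾β = g↾β}` for `β < ω₁`. -/
def boundedTopology (X : Set.Iio (Cardinal.aleph 1).ord → Type v) :
    TopologicalSpace (∀ α, X α) :=
  TopologicalSpace.generateFrom
    {U | ∃ (g : ∀ α, X α) (β : Ordinal), β < (Cardinal.aleph 1).ord ∧
      U = {f | ∀ α : Set.Iio (Cardinal.aleph 1).ord, (α : Ordinal) < β → f α = g α}}

section TreeLemmas

variable {T : Type u} [PartialOrder T]

/-- `t` is minimal or on a successor level, so that `Vset t` is a subbasic open set. -/
def IsWedgeBase (t : T) : Prop := IsMin t ∨ SuccLevel t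

lemma IsTreeOrder.le_total_of_le (htree : IsTreeOrder T) {a b x : T} (ha : a ≤ x) (hb : b ≤ x) :
    a ≤ b ∨ b ≤ a := by
  rcases ha.eq_or_lt with rfl | ha
  · exact Or.inr hb
  rcases hb.eq_or_lt with rfl | hb
  · exact Or.inl ha.le
  have := htree x
  rcases trichotomous_of (· < ·) (⟨a, ha⟩ : {y : T // y < x}) ⟨b, hb⟩ with h | h | h
  · exact Or.inl (Subtype.coe_lt_coe.2 h).le
  · exact Or.inl (Subtype.ext_iff.1 h).le
  · exact Or.inr (Subtype.coe_lt_coe.2 h).le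

lemma IsTreeOrder.typein_eq_htx (htree : IsTreeOrder T) {x : T} (y : {y : T // y < x}) :
    (haveI := htree x; typein (α := {y : T // y < x}) (· < ·) y) = htx y.1 := by
  have := htree x
  have := htree y.1
  rw [htx, dif_pos (htree y.1), ← type_subrel]
  refine type_eq.2 ⟨⟨⟨fun z => ⟨z.1.1, z.2⟩, fun z => ⟨⟨z.1, z.2.trans y.2⟩, z.2⟩, ?_, ?_⟩, ?_⟩⟩
  · intro z; rfl
  · intro z; rfl
  · intro a b; rfl

lemma IsTreeOrder.htx_lt_htx (htree : IsTreeOrder T) {x y : T} (h : y < x) : htx y < htx x := by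
  have := htree x
  rw [← htree.typein_eq_htx ⟨y, h⟩]
  conv_rhs => rw [htx, dif_pos (htree x)]
  exact typein_lt_type _ _

lemma IsTreeOrder.exists_htx_eq (htree : IsTreeOrder T) {x : T} {o : Ordinal.{u}}
    (h : o < htx x) : ∃ y < x, htx y = o := by
  have := htree x
  rw [htx, dif_pos (htree x)] at h
  obtain ⟨y, hy⟩ := typein_surj _ h
  exact ⟨y.1, y.2, by rw [← htree.typein_eq_htx y, hy]⟩

lemma IsTreeOrder.le_of_htx_le (htree : IsTreeOrder T) {x y z : T} (hy : y ≤ x) (hz : z ≤ x)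
    (h : htx y ≤ htx z) : y ≤ z := by
  rcases htree.le_total_of_le hy hz with h' | h'
  · exact h'
  rcases h'.eq_or_lt with rfl | h'
  · exact le_rfl
  exact absurd (htree.htx_lt_htx h') h.not_gt

lemma IsTreeOrder.exists_mem_ims_le (htree : IsTreeOrder T) {m x : T} (h : m < x) :
    ∃ r ∈ ims m, r ≤ x := by
  rcases (Order.add_one_le_of_lt (htree.htx_lt_htx h)).eq_or_lt with h' | h'
  · exact ⟨x, ⟨h, h'.symm⟩, le_rfl⟩
  · obtain ⟨r, hr, hr'⟩ := htree.exists_htx_eq h'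
    refine ⟨r, ⟨?_, hr'⟩, hr.le⟩
    have hlt : htx m < htx r := hr' ▸ Order.lt_add_one_iff.2 le_rfl
    refine lt_of_le_of_ne (htree.le_of_htx_le h.le hr.le hlt.le) ?_
    rintro rfl
    exact hlt.false

lemma IsTreeOrder.le_of_lt_of_mem_ims (htree : IsTreeOrder T) {m r z : T} (hr : r ∈ ims m)
    (hz : z < r) : z ≤ m := by
  refine htree.le_of_htx_le hz.le hr.1.le ?_
  have := htree.htx_lt_htx hz
  rw [hr.2] at this
  exact Order.lt_add_one_iff.1 this

lemma SuccLevel.exists_pred (htree : IsTreeOrder T) {x : T} (hx : SuccLevel x) :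
    ∃ p < x, x ∈ ims p := by
  obtain ⟨β, hβ⟩ := hx
  obtain ⟨p, hp, hp'⟩ := htree.exists_htx_eq (x := x) (o := β)
    (hβ ▸ Order.lt_add_one_iff.2 le_rfl)
  exact ⟨p, hp, hp, by rw [hβ, hp']⟩

lemma isWedgeBase_of_mem_ims {m r : T} (hr : r ∈ ims m) : IsWedgeBase r := Or.inr ⟨_, hr.2⟩

lemma IsTreeOrder.isWedgeBase_or_aleph0_le (htree : IsTreeOrder T) (x : T) :
    IsWedgeBase x ∨ aleph0 ≤ cfx x := by
  rcases zero_or_succ_or_isSuccLimit (htx x) with h | ⟨o, h⟩ | h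
  · refine Or.inl (Or.inl fun y hy => ?_)
    by_contra hxy
    have := htree.htx_lt_htx (lt_of_le_not_ge hy hxy)
    rw [h] at this
    exact not_lt_zero this
  · exact Or.inl (Or.inr ⟨o, h.symm⟩)
  · exact Or.inr (Ordinal.aleph0_le_cof_iff.2 (Ordinal.one_lt_cof_iff.2 h))

lemma isGreatest_wedge (htree : IsTreeOrder T) (hcc : ChainComplete T) (s t : T) :
    IsGreatest {r : T | r ≤ s ∧ r ≤ t} (wedge s t) := by
  have h : ∃ m, IsGreatest {r : T | r ≤ s ∧ r ≤ t} m := by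
    obtain ⟨m, hm⟩ := hcc {r : T | r ≤ s ∧ r ≤ t}
      (fun a ha b hb _ => htree.le_total_of_le ha.1 hb.1)
    exact ⟨m, ⟨hm.2 fun r hr => hr.1, hm.2 fun r hr => hr.2⟩, hm.1⟩
  rw [wedge, dif_pos h]
  exact h.choose_spec

lemma wedge_eq_of_isGreatest (htree : IsTreeOrder T) (hcc : ChainComplete T) {s t m : T}
    (h : IsGreatest {r : T | r ≤ s ∧ r ≤ t} m) : wedge s t = m :=
  (isGreatest_wedge htree hcc s t).unique h

lemma wedge_eq_of_mem_ims (htree : IsTreeOrder T) (hcc : ChainComplete T) {a b m r : T}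
    (hr : r ∈ ims m) (hma : m ≤ a) (hra : ¬ r ≤ a) (hrb : r ≤ b) : wedge a b = m := by
  refine wedge_eq_of_isGreatest htree hcc ⟨⟨hma, hr.1.le.trans hrb⟩, fun z hz => ?_⟩
  rcases htree.le_total_of_le hz.2 hrb with h | h
  · rcases h.eq_or_lt with rfl | h
    · exact absurd hz.1 hra
    · exact htree.le_of_lt_of_mem_ims hr h
  · exact absurd (h.trans hz.1) hra

lemma exists_isWedgeBase_le_not_le (htree : IsTreeOrder T) (hcc : ChainComplete T) {x y : T}
    (h : ¬ x ≤ y) : ∃ s, IsWedgeBase s ∧ s ≤ x ∧ ¬ s ≤ y := by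
  have hm := isGreatest_wedge htree hcc x y
  have hlt : wedge x y < x := lt_of_le_of_ne hm.1.1 fun he => h (he ▸ hm.1.2)
  obtain ⟨r, hr, hrx⟩ := htree.exists_mem_ims_le hlt
  exact ⟨r, isWedgeBase_of_mem_ims hr, hrx, fun hry => (hm.2 ⟨hrx, hry⟩).not_gt hr.1⟩

lemma exists_isWedgeBase_not_le_of_countable (htree : IsTreeOrder T) {x : T}
    (hx : Cardinal.aleph 1 ≤ cfx x) {S : Set T} (hS : S.Countable) :
    ∃ s, IsWedgeBase s ∧ s ≤ x ∧ ∀ a ∈ S, a < x → ¬ s ≤ a := by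
  have hS' : (S ∩ Iio x).Countable := hS.mono inter_subset_left
  have hlt : (⨆ a : ↥(S ∩ Iio x), htx a.1) < htx x := by
    refine iSup_lt_of_lt_cof (lt_of_lt_of_le ?_ hx) fun a => htree.htx_lt_htx a.2.2
    refine lt_of_le_of_lt (Cardinal.le_aleph0_iff_set_countable.2 hS') ?_
    rw [← Cardinal.aleph_zero]
    exact Cardinal.aleph_lt_aleph.2 zero_lt_one
  obtain ⟨m, hm, hm'⟩ := htree.exists_htx_eq hlt
  obtain ⟨r, hr, hrx⟩ := htree.exists_mem_ims_le hm
  refine ⟨r, isWedgeBase_of_mem_ims hr, hrx, fun a ha hax hra => ?_⟩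
  have hle : htx a ≤ htx m := by
    rw [hm']
    exact Ordinal.le_iSup (fun a : ↥(S ∩ Iio x) => htx a.1) ⟨a, ha, hax⟩
  exact (htree.le_of_htx_le hax.le hm.le hle).not_gt (hr.1.trans_le hra)

end TreeLemmas

section CoarseWedge

variable {T : Type u} [PartialOrder T] [τ : TopologicalSpace T]

lemma isClopen_Vset (hτ : τ = coarseWedge T) {s : T} (hs : IsWedgeBase s) :
    IsClopen (Vset s) := by
  have key : ∀ U, (U = Vset s ∨ U = (Vset s)ᶜ) → IsOpen U := fun U hU => by
    rw [hτ]
    exact TopologicalSpace.isOpen_generateFrom_of_mem ⟨s, hs, hU⟩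
  exact ⟨⟨key _ (Or.inr rfl)⟩, key _ (Or.inl rfl)⟩

lemma t2Space_of_coarseWedge (hτ : τ = coarseWedge T) (htree : IsTreeOrder T)
    (hcc : ChainComplete T) : T2Space T := by
  have key : ∀ x y : T, ¬ x ≤ y →
      ∃ U V : Set T, IsOpen U ∧ IsOpen V ∧ x ∈ U ∧ y ∈ V ∧ Disjoint U V := by
    intro x y h
    obtain ⟨s, hs, hsx, hsy⟩ := exists_isWedgeBase_le_not_le htree hcc h
    have hc := isClopen_Vset hτ hs
    exact ⟨Vset s, (Vset s)ᶜ, hc.isOpen, hc.compl.isOpen, hsx, hsy, disjoint_compl_right⟩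
  refine ⟨fun x y hxy => ?_⟩
  by_cases h : x ≤ y
  · obtain ⟨U, V, hU, hV, hyU, hxV, hd⟩ := key y x fun h' => hxy (le_antisymm h h')
    exact ⟨V, U, hV, hU, hxV, hyU, hd.symm⟩
  · exact key x y h

lemma compactSpace_of_coarseWedge (hτ : τ = coarseWedge T) (htree : IsTreeOrder T)
    (hcc : ChainComplete T) {root : T} (hroot : ∀ x : T, root ≤ x) : CompactSpace T := by
  refine compactSpace_generateFrom hτ fun P hP hcov => ?_
  set C : Set T := {t | (Vset t)ᶜ ∈ P} with hC
  by_cases hchain : IsChain (· ≤ ·) C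
  · obtain ⟨m, hm⟩ := hcc C hchain
    obtain ⟨U, hU, hmU⟩ : m ∈ ⋃₀ P := hcov ▸ mem_univ m
    obtain ⟨s, hs, rfl | rfl⟩ := hP hU
    · rcases hs with hs | hs
      · refine ⟨{Vset s}, by simpa using hU, finite_singleton _, ?_⟩
        rw [sUnion_singleton]
        exact eq_univ_of_forall fun x => (hs (hroot s)).trans (hroot x)
      · obtain ⟨p, hp, hsp⟩ := hs.exists_pred htree
        obtain ⟨t, ht, hst⟩ : ∃ t ∈ C, s ≤ t := by
          by_contra! hno
          refine hp.not_ge (le_trans hmU (hm.2 fun t ht => ?_))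
          rcases htree.le_total_of_le (hm.1 ht) hmU with h | h
          · exact htree.le_of_lt_of_mem_ims hsp
              (lt_of_le_of_ne h fun he => hno t ht he.ge)
          · exact absurd h (hno t ht)
        refine ⟨{Vset s, (Vset t)ᶜ}, ?_, toFinite _, ?_⟩
        · rintro U (rfl | rfl)
          exacts [hU, ht]
        · rw [sUnion_pair]
          refine eq_univ_of_forall fun x => ?_
          by_cases hx : t ≤ x
          · exact Or.inl (hst.trans hx)
          · exact Or.inr hx
    · exact absurd (hm.1 (show s ∈ C from hU)) hmU
  · simp only [IsChain, Set.Pairwise, not_forall] at hchain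
    obtain ⟨s, hs, t, ht, -, hst⟩ := hchain
    refine ⟨{(Vset s)ᶜ, (Vset t)ᶜ}, ?_, toFinite _, ?_⟩
    · rintro U (rfl | rfl)
      exacts [hs, ht]
    · rw [sUnion_pair, ← compl_inter, compl_univ_iff]
      refine eq_empty_of_forall_notMem fun x hx => hst ?_
      exact htree.le_total_of_le hx.1 hx.2

variable {root : T} {φ : T → ℕ → T} {A : Set T}

/-- A point of `closure A` outside a wedge-closed set `A` is approached by `A` from below. -/
lemma exists_mem_lt_of_mem_closure (hτ : τ = coarseWedge T) (htree : IsTreeOrder T)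
    (hcc : ChainComplete T) (hA : ∀ s ∈ A, ∀ t ∈ A, wedge s t ∈ A) {x s : T}
    (hx : x ∈ closure A) (hxA : x ∉ A) (hs : IsWedgeBase s) (hsx : s ≤ x) :
    ∃ a ∈ A, s ≤ a ∧ a < x := by
  have key : ∀ a ∈ A, s ≤ a → ¬ x ≤ a → ∃ a ∈ A, s ≤ a ∧ a < x := by
    intro a ha hsa hxa
    have hm := isGreatest_wedge htree hcc a x
    have hlt : wedge a x < x := lt_of_le_of_ne hm.1.2 fun he => hxa (he ▸ hm.1.1)
    obtain ⟨r, hr, hrx⟩ := htree.exists_mem_ims_le hlt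
    obtain ⟨b, hrb, hb⟩ := mem_closure_iff.1 hx _
      (isClopen_Vset hτ (isWedgeBase_of_mem_ims hr)).isOpen hrx
    have hra : ¬ r ≤ a := fun h => (hm.2 ⟨h, hrx⟩).not_gt hr.1
    have := wedge_eq_of_mem_ims htree hcc hr hm.1.1 hra hrb
    exact ⟨wedge a x, this ▸ hA a ha b hb, hm.2 ⟨hsa, hsx⟩, hlt⟩
  have hVs := (isClopen_Vset hτ hs).isOpen
  obtain ⟨a, hsa, ha⟩ := mem_closure_iff.1 hx _ hVs hsx
  by_cases hxa : x ≤ a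
  · have hlt : x < a := lt_of_le_of_ne hxa fun he => hxA (he ▸ ha)
    obtain ⟨r, hr, hra⟩ := htree.exists_mem_ims_le hlt
    obtain ⟨b, ⟨hsb, hrb⟩, hb⟩ := mem_closure_iff.1 hx _
      (hVs.inter (isClopen_Vset hτ (isWedgeBase_of_mem_ims hr)).compl.isOpen)
      ⟨hsx, hr.1.not_ge⟩
    refine key b hb hsb fun hxb => hxA ?_
    exact wedge_eq_of_mem_ims htree hcc hr hxb hrb hra ▸ hA b hb a ha
  · exact key a ha hsa hxa

/-- Points of uncountable cofinality are isolated in `closure A` (or outside of it). -/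
lemma exists_isOpen_inter_subset_singleton (hτ : τ = coarseWedge T) (htree : IsTreeOrder T)
    (hcc : ChainComplete T) (hstar : StarCond T) (hA : Admissible root φ A) {x : T}
    (hx : Cardinal.aleph 1 ≤ cfx x) : ∃ U, IsOpen U ∧ x ∈ U ∧ U ∩ A ⊆ {x} := by
  obtain ⟨s, hs, hsx, hsA⟩ := exists_isWedgeBase_not_le_of_countable htree hx hA.countable
  by_cases hxA : x ∈ A
  · refine ⟨Vset s ∩ ⋂ r ∈ ims x, (Vset r)ᶜ, ?_, ⟨hsx, ?_⟩, ?_⟩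
    · exact (isClopen_Vset hτ hs).isOpen.inter ((hstar x hx).isOpen_biInter fun r hr =>
        (isClopen_Vset hτ (isWedgeBase_of_mem_ims hr)).compl.isOpen)
    · exact mem_iInter₂.2 fun r hr => hr.1.not_ge
    · rintro a ⟨⟨hsa, hra⟩, ha⟩
      have hm := isGreatest_wedge htree hcc a x
      have heq : wedge a x = x := by
        by_contra hne
        exact hsA _ (hA.wedge_mem a ha x hxA) (lt_of_le_of_ne hm.1.2 hne) (hm.2 ⟨hsa, hsx⟩)
      have hxa : x ≤ a := heq ▸ hm.1.1
      by_contra hne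
      obtain ⟨r, hr, hra'⟩ := htree.exists_mem_ims_le (lt_of_le_of_ne hxa (Ne.symm hne))
      exact mem_iInter₂.1 hra r hr hra'
  · refine ⟨(closure A)ᶜ, isClosed_closure.isOpen_compl, fun hcl => ?_, ?_⟩
    · obtain ⟨a, ha, hsa, hax⟩ :=
        exists_mem_lt_of_mem_closure hτ htree hcc hA.wedge_mem hcl hxA hs hsx
      exact hsA a ha hax hsa
    · rintro a ⟨ha, ha'⟩
      exact absurd (subset_closure ha') ha

lemma exists_mem_isWedgeBase_of_mem (hτ : τ = coarseWedge T) (htree : IsTreeOrder T)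
    (hcc : ChainComplete T) (hφ : PhiSpec root φ) (hA : Admissible root φ A) {a y : T}
    (ha : a ∈ A) (hcf : cfx a ≤ aleph0) (hay : ¬ a ≤ y) :
    ∃ b ∈ A, IsWedgeBase b ∧ b ≤ a ∧ ¬ b ≤ y := by
  rcases htree.isWedgeBase_or_aleph0_le a with h | h
  · exact ⟨a, ha, h, le_rfl, hay⟩
  obtain ⟨hφa, hlim⟩ := (hφ a).2 (le_antisymm hcf h)
  obtain ⟨s, hs, hsa, hsy⟩ := exists_isWedgeBase_le_not_le htree hcc hay
  obtain ⟨n, hn⟩ := (hlim.eventually ((isClopen_Vset hτ hs).isOpen.mem_nhds hsa)).exists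
  exact ⟨φ a n, hA.phi_mem a ha n, Or.inr (hφa n).2, (hφa n).1.le, fun h => hsy (hn.trans h)⟩

/-- The wedges based at points of `A` separate the points of `closure A` of countable
cofinality. -/
lemma exists_mem_isWedgeBase_of_mem_closure (hτ : τ = coarseWedge T) (htree : IsTreeOrder T)
    (hcc : ChainComplete T) (hφ : PhiSpec root φ) (hA : Admissible root φ A) {x y : T}
    (hx : x ∈ closure A) (hcf : cfx x ≤ aleph0) (hxy : ¬ x ≤ y) :
    ∃ b ∈ A, IsWedgeBase b ∧ b ≤ x ∧ ¬ b ≤ y := by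
  by_cases hxA : x ∈ A
  · exact exists_mem_isWedgeBase_of_mem hτ htree hcc hφ hA hxA hcf hxy
  obtain ⟨s, hs, hsx, hsy⟩ := exists_isWedgeBase_le_not_le htree hcc hxy
  obtain ⟨a, ha, hsa, hax⟩ :=
    exists_mem_lt_of_mem_closure hτ htree hcc hA.wedge_mem hx hxA hs hsx
  have hay : ¬ a ≤ y := fun h => hsy (hsa.trans h)
  by_cases hacf : cfx a ≤ aleph0
  · obtain ⟨b, hb, hb', hba, hby⟩ :=
      exists_mem_isWedgeBase_of_mem hτ htree hcc hφ hA ha hacf hay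
    exact ⟨b, hb, hb', hba.trans hax.le, hby⟩
  · have ha1 : Cardinal.aleph 1 ≤ cfx a := by
      rw [← Cardinal.succ_aleph0]
      exact Order.succ_le_of_lt (not_le.1 hacf)
    obtain ⟨r, hr, hrx⟩ := htree.exists_mem_ims_le hax
    have hrA := hA.psi_mem a ha
    rw [psiSet, if_pos ha1] at hrA
    exact ⟨r, hrA hr, isWedgeBase_of_mem_ims hr, hrx, fun h => hay (hr.1.le.trans h)⟩

lemma isClosed_closure_inter_cfx_le (hτ : τ = coarseWedge T) (htree : IsTreeOrder T)
    (hcc : ChainComplete T) (hstar : StarCond T) (hA : Admissible root φ A) :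
    IsClosed (closure A ∩ {u : T | cfx u ≤ aleph0}) := by
  have := t2Space_of_coarseWedge hτ htree hcc
  rw [← isOpen_compl_iff, isOpen_iff_forall_mem_open]
  intro x hx
  by_cases hxc : x ∈ closure A
  · have hx1 : Cardinal.aleph 1 ≤ cfx x := by
      rw [← Cardinal.succ_aleph0]
      exact Order.succ_le_of_lt (not_le.1 fun h => hx ⟨hxc, h⟩)
    obtain ⟨U, hU, hxU, hUA⟩ :=
      exists_isOpen_inter_subset_singleton hτ htree hcc hstar hA hx1
    refine ⟨U, fun y hyU hy => hx ?_, hU, hxU⟩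
    have hyx : y ∈ closure {x} := closure_mono hUA (hU.inter_closure ⟨hyU, hy.1⟩)
    rw [closure_singleton] at hyx
    exact mem_singleton_iff.1 hyx ▸ hy
  · exact ⟨(closure A)ᶜ, fun y hy hy' => hy hy'.1, isClosed_closure.isOpen_compl, hxc⟩

end CoarseWedge

theorem stmt9 {T : Type u} [PartialOrder T] [τ : TopologicalSpace T]
    (hτ : τ = coarseWedge T) (htree : IsTreeOrder T) (hcc : ChainComplete T)
    (root : T) (hroot : ∀ x : T, root ≤ x)
    (hstar : StarCond T) (φ : T → ℕ → T) (hφ : PhiSpec root φ)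
    (A : Set T) (hA : Admissible root φ A) :
    IsCompact (closure A ∩ {u : T | cfx u ≤ Cardinal.aleph0}) ∧
    TopologicalSpace.MetrizableSpace ↥(closure A ∩ {u : T | cfx u ≤ Cardinal.aleph0}) := by
  have := t2Space_of_coarseWedge hτ htree hcc
  have := compactSpace_of_coarseWedge hτ htree hcc hroot
  have hcomp := (isClosed_closure_inter_cfx_le hτ htree hcc hstar hA).isCompact
  refine ⟨hcomp, ?_⟩
  have := isCompact_iff_compactSpace.1 hcomp
  have : Countable {a : T // a ∈ A ∧ IsWedgeBase a} :=
    (hA.countable.mono fun a (ha : a ∈ A ∧ IsWedgeBase a) => ha.1).to_subtype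
  classical
  let f : ↥(closure A ∩ {u : T | cfx u ≤ Cardinal.aleph0}) →
      {a : T // a ∈ A ∧ IsWedgeBase a} → Bool := fun x a => decide (a.1 ≤ x.1)
  have hf : Continuous f := by
    refine continuous_pi fun a => (continuous_bool_rng true).2 ?_
    have : (fun x => f x a) ⁻¹' {true} = Subtype.val ⁻¹' Vset a.1 := by
      ext x
      simp [f, Vset]
    rw [this]
    exact (isClopen_Vset hτ a.2.2).preimage continuous_subtype_val
  have hle : ∀ x y, f x = f y → x.1 ≤ y.1 := by
    intro x y hxy
    by_contra h
    obtain ⟨b, hb, hb', hbx, hby⟩ :=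
      exists_mem_isWedgeBase_of_mem_closure hτ htree hcc hφ hA x.2.1 x.2.2 h
    have := congrFun hxy ⟨b, hb, hb'⟩
    simp [f, hbx, hby] at this
  have hinj : Function.Injective f := fun x y hxy =>
    Subtype.ext (le_antisymm (hle x y hxy) (hle y x hxy.symm))
  exact (hf.isClosedEmbedding hinj).isEmbedding.metrizableSpace
end

section
/- Let T be a rooted chain complete tree satisfying condition (*), endowed with the coarse wedge topology, let D = {t ∈ T : cf(t) ≤ ω}, and for A ∈ 𝒜(T) let r_A(t) = max(t̂ ∩ cl(A) ∩ D). If A₁ ⊆ A₂ ⊆ … is an increasing sequence in 𝒜(T) and A = ⋃_{n∈ω} A_n, then A ∈ 𝒜(T) and for every t ∈ T the sequence r_{A_n}(t) converges to r_A(t); in fact r_A(t) = sup_{n∈ω} r_{A_n}(t). -/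
open Cardinal Ordinal Filter Set Topology

universe u v

section TreeLemmas

variable {T : Type u} [PartialOrder T]

theorem IsTreeOrder.wellFounded (h : IsTreeOrder T) : WellFounded ((· < ·) : T → T → Prop) := by
  refine ⟨fun x => ⟨x, fun y hy => ?_⟩⟩
  have hwf := (h x).toIsWellFounded.wf
  have key : ∀ z : {y : T // y < x}, Acc ((· < ·) : T → T → Prop) z.1 := by
    intro z
    induction z using hwf.induction with
    | _ z ih => exact ⟨_, fun w hw => ih ⟨w, hw.trans z.2⟩ hw⟩
  exact key ⟨y, hy⟩

theorem IsTreeOrder.le_total_of_le_s11 (h : IsTreeOrder T) {x y z : T} (hy : y ≤ x) (hz : z ≤ x) :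
    y ≤ z ∨ z ≤ y := by
  rcases hy.eq_or_lt with rfl | hy
  · exact Or.inr hz
  rcases hz.eq_or_lt with rfl | hz
  · exact Or.inl hy.le
  have := h x
  rcases trichotomous_of (· < ·) (⟨y, hy⟩ : {y : T // y < x}) ⟨z, hz⟩ with h | h | h
  · exact Or.inl (le_of_lt h)
  · exact Or.inl (congrArg Subtype.val h).le
  · exact Or.inr (le_of_lt h)

theorem IsTreeOrder.htx_eq_add_one (h : IsTreeOrder T) {p x : T}
    (hp : IsGreatest (Iio x) p) : htx x = htx p + 1 := by
  have hx := h x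
  have hp' := h p
  rw [htx, htx, dif_pos hx, dif_pos hp', ← Ordinal.type_eq_one_of_unique (emptyRelation (α := PUnit)),
    ← Ordinal.type_sum_lex]
  refine Quotient.sound ⟨RelIso.symm ?_⟩
  let f : {y : T // y < p} ⊕ PUnit → {y : T // y < x} :=
    Sum.elim (fun y => ⟨y.1, y.2.trans hp.1⟩) (fun _ => ⟨p, hp.1⟩)
  have hf : Function.Bijective f := by
    constructor
    · rintro (⟨a, ha⟩ | a) (⟨b, hb⟩ | b) hab
      · simpa [f] using hab
      · exact absurd (congrArg Subtype.val hab) ha.ne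
      · exact absurd (congrArg Subtype.val hab).symm hb.ne
      · rfl
    · rintro ⟨y, hy⟩
      rcases (hp.2 hy).eq_or_lt with rfl | hlt
      · exact ⟨Sum.inr PUnit.unit, rfl⟩
      · exact ⟨Sum.inl ⟨y, hlt⟩, rfl⟩
  refine ⟨Equiv.ofBijective f hf, ?_⟩
  rintro (⟨a, ha⟩ | a) (⟨b, hb⟩ | b)
  · simp [f]
  · exact iff_of_true (show a < p from ha) (Sum.Lex.sep _ _)
  · exact iff_of_false (show ¬ p < b from hb.not_gt) Sum.lex_inr_inl
  · simp [f]

theorem cfx_le_aleph0_of_succLevel {x : T} (hx : SuccLevel x) : cfx x ≤ Cardinal.aleph0 := by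
  obtain ⟨β, hβ⟩ := hx
  rw [cfx, hβ, Ordinal.cof_add_one]
  exact Cardinal.one_le_aleph0

theorem IsTreeOrder.exists_isGreatest_Iio_of_htx (h : IsTreeOrder T) {x : T} {β : Ordinal}
    (hβ : htx x = β + 1) : ∃ p, IsGreatest (Iio x) p := by
  have hx := h x
  rw [htx, dif_pos hx] at hβ
  have hlt : β < Ordinal.type ((· < ·) : {y : T // y < x} → {y : T // y < x} → Prop) := by
    rw [hβ]; exact Order.lt_add_one_iff.2 le_rfl
  obtain ⟨p, hp⟩ := Ordinal.typein_surj _ hlt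
  refine ⟨p.1, p.2, fun y hy => ?_⟩
  have hy' := Ordinal.typein_lt_type ((· < ·) : {y : T // y < x} → {y : T // y < x} → Prop) ⟨y, hy⟩
  rw [hβ, Order.lt_add_one_iff, ← hp, Ordinal.typein_le_typein] at hy'
  rcases h.le_total_of_le_s11 (le_of_lt hy) p.2.le with hle | hle
  · exact hle
  · rcases hle.eq_or_lt with he | hl
    · exact he.ge
    · exact absurd hl hy'

/-- The immediate successor of `s` in the direction of `r`. -/
theorem IsTreeOrder.exists_isGreatest_Iio (h : IsTreeOrder T) {s r : T} (hsr : s < r) :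
    ∃ x ≤ r, IsGreatest (Iio x) s := by
  obtain ⟨x, ⟨hsx, hxr⟩, hmin⟩ := h.wellFounded.has_min {y | s < y ∧ y ≤ r} ⟨r, hsr, le_rfl⟩
  refine ⟨x, hxr, hsx, fun y hy => ?_⟩
  have hyr : y ≤ r := (le_of_lt hy).trans hxr
  rcases h.le_total_of_le_s11 hyr hsr.le with hle | hle
  · exact hle
  rcases hle.eq_or_lt with rfl | hlt
  · exact le_rfl
  · exact absurd hy (hmin y ⟨hlt, hyr⟩)

/-- In a chain complete tree, a point `m` with `¬ m ≤ r` has a predecessor on a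
successor level with the same property. -/
theorem IsTreeOrder.exists_succLevel_not_le (h : IsTreeOrder T) (hcc : ChainComplete T)
    {m r : T} (hmr : ¬ m ≤ r) : ∃ x ≤ m, SuccLevel x ∧ ¬ x ≤ r := by
  obtain ⟨x, ⟨hxm, hxr⟩, hmin⟩ := h.wellFounded.has_min {y | y ≤ m ∧ ¬ y ≤ r} ⟨m, le_rfl, hmr⟩
  have hlow : ∀ y < x, y ≤ r := fun y hy => by
    by_contra hyr
    exact hmin y ⟨hy.le.trans hxm, hyr⟩ hy
  obtain ⟨z, hz⟩ := hcc (Iio x) fun a ha b hb _ => h.le_total_of_le_s11 (le_of_lt ha) (le_of_lt hb)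
  have hzx : z ≤ x := hz.2 fun _ hy => le_of_lt hy
  rcases hzx.eq_or_lt with rfl | hlt
  · exact absurd (hz.2 hlow) hxr
  · exact ⟨x, hxm, ⟨_, h.htx_eq_add_one ⟨hlt, hz.1⟩⟩, hxr⟩

theorem IsTreeOrder.wedge_isGreatest (h : IsTreeOrder T) (hcc : ChainComplete T) (s t : T) :
    IsGreatest {r : T | r ≤ s ∧ r ≤ t} (wedge s t) := by
  have hex : ∃ m, IsGreatest {r : T | r ≤ s ∧ r ≤ t} m := by
    obtain ⟨m, hm⟩ := hcc {r : T | r ≤ s ∧ r ≤ t} fun a ha b hb _ => h.le_total_of_le_s11 ha.1 hb.1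
    exact ⟨m, ⟨hm.2 fun _ hy => hy.1, hm.2 fun _ hy => hy.2⟩, hm.1⟩
  rw [wedge, dif_pos hex]
  exact hex.choose_spec

theorem isOpen_Vset [τ : TopologicalSpace T] (hτ : τ = coarseWedge T) {t : T}
    (ht : SuccLevel t) : IsOpen (Vset t) := by
  subst hτ
  exact TopologicalSpace.isOpen_generateFrom_of_mem ⟨t, Or.inr ht, Or.inl rfl⟩

theorem isOpen_compl_Vset [τ : TopologicalSpace T] (hτ : τ = coarseWedge T) {t : T}
    (ht : SuccLevel t) : IsOpen (Vset t)ᶜ := by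
  subst hτ
  exact TopologicalSpace.isOpen_generateFrom_of_mem ⟨t, Or.inr ht, Or.inr rfl⟩

theorem Admissible.iUnion {root : T} {φ : T → ℕ → T} {A : ℕ → Set T}
    (hA : ∀ n, Admissible root φ (A n)) (hmono : Monotone A) : Admissible root φ (⋃ n, A n) where
  countable := countable_iUnion fun n => (hA n).countable
  root_mem := mem_iUnion.2 ⟨0, (hA 0).root_mem⟩
  wedge_mem s hs t ht := by
    obtain ⟨i, hi⟩ := mem_iUnion.1 hs
    obtain ⟨j, hj⟩ := mem_iUnion.1 ht
    exact mem_iUnion.2 ⟨max i j, (hA _).wedge_mem s (hmono (le_max_left i j) hi) t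
      (hmono (le_max_right i j) hj)⟩
  phi_mem t ht n := by
    obtain ⟨i, hi⟩ := mem_iUnion.1 ht
    exact mem_iUnion.2 ⟨i, (hA i).phi_mem t hi n⟩
  psi_mem t ht := by
    obtain ⟨i, hi⟩ := mem_iUnion.1 ht
    exact ((hA i).psi_mem t hi).trans (subset_iUnion A i)

/-- A monotone sequence with a supremum converges to it in the coarse wedge topology. -/
theorem IsTreeOrder.tendsto_of_isLUB (h : IsTreeOrder T) [τ : TopologicalSpace T]
    (hτ : τ = coarseWedge T) {f : ℕ → T} (hf : Monotone f) {s : T} (hs : IsLUB (range f) s) :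
    Tendsto f atTop (nhds s) := by
  subst hτ
  refine TopologicalSpace.tendsto_nhds_generateFrom_iff.2 ?_
  rintro _ ⟨u, hu, rfl | rfl⟩ hsu
  · suffices ∃ n, u ≤ f n by
      obtain ⟨n, hn⟩ := this
      filter_upwards [eventually_ge_atTop n] with m hm using hn.trans (hf hm)
    by_contra! hcon
    have hlt : ∀ n, f n < u := fun n => by
      rcases h.le_total_of_le_s11 (hs.1 (mem_range_self n)) hsu with hle | hle
      · exact hle.lt_of_ne fun he => hcon n he.ge
      · exact absurd hle (hcon n)
    have hus : u = s := le_antisymm hsu (hs.2 (forall_mem_range.2 fun n => (hlt n).le))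
    subst hus
    rcases hu with hu | ⟨β, hβ⟩
    · exact (hu.not_lt (hlt 0))
    · obtain ⟨p, hp⟩ := h.exists_isGreatest_Iio_of_htx hβ
      exact hp.1.not_ge (hs.2 (forall_mem_range.2 fun n => hp.2 (hlt n)))
  · exact Eventually.of_forall fun n hn => hsu (le_trans hn (hs.1 (mem_range_self n)))

/-- A point of countable cofinality in the closure of `⋃ n, A n` lies below every upper bound of
the points of countable cofinality of the `A n` below it. -/
theorem IsTreeOrder.le_of_mem_closure (h : IsTreeOrder T) (hcc : ChainComplete T)
    [τ : TopologicalSpace T] (hτ : τ = coarseWedge T) {root : T}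
    {φ : T → ℕ → T} {A : Set T} (hA : Admissible root φ A) {r s : T} (hr : r ∈ closure A)
    (hcr : cfx r ≤ Cardinal.aleph0) (hsr : s ≤ r)
    (hs : ∀ a ∈ A, a ≤ r → cfx a ≤ Cardinal.aleph0 → a ≤ s) : r ≤ s := by
  rcases hsr.eq_or_lt with rfl | hlt
  · exact le_rfl
  exfalso
  obtain ⟨u, hur, hu⟩ := h.exists_isGreatest_Iio hlt
  have husucc : SuccLevel u := ⟨_, h.htx_eq_add_one hu⟩
  have hne : (Vset u ∩ A).Nonempty := mem_closure_iff.1 hr _ (isOpen_Vset hτ husucc) hur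
  obtain ⟨m, ⟨hum, hmA⟩, hmin⟩ := h.wellFounded.has_min _ hne
  have hleast : ∀ a ∈ A, u ≤ a → m ≤ a := fun a ha hua => by
    have hw := h.wedge_isGreatest hcc m a
    rcases hw.1.1.eq_or_lt with he | hl
    · exact he ▸ hw.1.2
    · exact absurd hl (hmin _ ⟨hw.2 ⟨hum, hua⟩, hA.wedge_mem m hmA a ha⟩)
  have hsm : s < m := lt_of_lt_of_le hu.1 hum
  by_cases hmr : m ≤ r
  · by_cases hcm : cfx m ≤ Cardinal.aleph0
    · exact hsm.not_ge (hs m hmA hmr hcm)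
    · have hmr' : m < r := hmr.lt_of_ne fun he => hcm (he ▸ hcr)
      obtain ⟨v, hvr, hv⟩ := h.exists_isGreatest_Iio hmr'
      have hvh := h.htx_eq_add_one hv
      have hpsi : psiSet root m = ims m := if_pos (by
        rw [← Cardinal.succ_aleph0]
        exact Order.succ_le_of_lt (not_le.1 hcm))
      have hvA : v ∈ A := hA.psi_mem m hmA (hpsi ▸ ⟨hv.1, hvh⟩)
      exact (hsm.trans hv.1).not_ge (hs v hvA hvr (cfx_le_aleph0_of_succLevel ⟨_, hvh⟩))
  · obtain ⟨x, hxm, hx, hxr⟩ := h.exists_succLevel_not_le hcc hmr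
    obtain ⟨a, ⟨hua, hxa⟩, haA⟩ := mem_closure_iff.1 hr _
      ((isOpen_Vset hτ husucc).inter (isOpen_compl_Vset hτ hx)) ⟨hur, hxr⟩
    exact hxa (hxm.trans (hleast a haA hua))

end TreeLemmas

theorem stmt11 {T : Type u} [PartialOrder T] [τ : TopologicalSpace T]
    (hτ : τ = coarseWedge T) (htree : IsTreeOrder T) (hcc : ChainComplete T)
    (root : T) (hroot : ∀ x : T, root ≤ x)
    (hstar : StarCond T) (φ : T → ℕ → T) (hφ : PhiSpec root φ)
    (A : ℕ → Set T) (hA : ∀ n, Admissible root φ (A n)) (hmono : Monotone A)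
    (rA : ℕ → T → T)
    (hrA : ∀ n, ∀ t : T, IsGreatest ({s : T | s ≤ t} ∩ closure (A n) ∩ {u : T | cfx u ≤ Cardinal.aleph0}) (rA n t))
    (rU : T → T)
    (hrU : ∀ t : T, IsGreatest ({s : T | s ≤ t} ∩ closure (⋃ n, A n) ∩ {u : T | cfx u ≤ Cardinal.aleph0}) (rU t)) :
    Admissible root φ (⋃ n, A n) ∧
    ∀ t : T, Tendsto (fun n => rA n t) atTop (nhds (rU t)) ∧
      IsLUB (Set.range fun n => rA n t) (rU t) := by
  have hU := Admissible.iUnion hA hmono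
  refine ⟨hU, fun t => ?_⟩
  have hf : Monotone fun n => rA n t := fun i j hij =>
    (hrA j t).2 ⟨⟨(hrA i t).1.1.1, closure_mono (hmono hij) (hrA i t).1.1.2⟩, (hrA i t).1.2⟩
  have hub : rU t ∈ upperBounds (range fun n => rA n t) := forall_mem_range.2 fun n =>
    (hrU t).2 ⟨⟨(hrA n t).1.1.1, closure_mono (subset_iUnion A n) (hrA n t).1.1.2⟩, (hrA n t).1.2⟩
  obtain ⟨s, hs⟩ := hcc (range fun n => rA n t) hf.isChain_range
  have hle : rU t ≤ s := by
    refine htree.le_of_mem_closure hcc hτ hU (hrU t).1.1.2 (hrU t).1.2 (hs.2 hub) ?_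
    intro a ha hat hca
    obtain ⟨n, hn⟩ := mem_iUnion.1 ha
    exact ((hrA n t).2 ⟨⟨hat.trans (hrU t).1.1.1, subset_closure hn⟩, hca⟩).trans
      (hs.1 (mem_range_self n))
  have hlub : IsLUB (range fun n => rA n t) (rU t) := le_antisymm (hs.2 hub) hle ▸ hs
  exact ⟨htree.tendsto_of_isLUB hτ hf hlub, hlub⟩
end

section
/- Let T be the tree consisting of all functions f : β → 2 with β ≤ ω₁, together with, for each f : ω₁ → 2, the single extension f⌢⟨0⟩ of length ω₁ + 1, ordered by end-extension, and endowed with the coarse wedge topology. Then T does not contain any homeomorphic copy of the ordinal space [0,ω₂] with the order topology. -/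
open Cardinal Ordinal Filter Set Topology

universe u v

/-- The ordinal `ω₁`. -/
noncomputable def omega1 : Ordinal.{0} := (Cardinal.aleph 1).ord

/-- The tree of all functions `f : β → 2` with `β ≤ ω₁`, together with, for each
`f : ω₁ → 2`, the single extension `f⌢⟨0⟩` of length `ω₁ + 1`.  An element is coded
as a pair `(β, f)` with `β ≤ ω₁ + 1` and `f : Iio β → Bool`, where the value at the
coordinate `ω₁` (if present) is `false`. -/
def TreeEx : Type 1 :=
  {p : (β : Ordinal.{0}) × (Set.Iio β → Bool) //
    p.1 ≤ omega1 + 1 ∧ ∀ h : omega1 < p.1, p.2 ⟨omega1, h⟩ = false}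

/-- `TreeEx` is ordered by end-extension. -/
instance : PartialOrder TreeEx where
  le p q := p.1.1 ≤ q.1.1 ∧
    ∀ (α : Ordinal) (h1 : α < p.1.1) (h2 : α < q.1.1), p.1.2 ⟨α, h1⟩ = q.1.2 ⟨α, h2⟩
  le_refl p := ⟨le_rfl, fun _ _ _ => rfl⟩
  le_trans p q r hpq hqr := ⟨hpq.1.trans hqr.1, fun α h1 h2 =>
    (hpq.2 α h1 (h1.trans_le hpq.1)).trans (hqr.2 α (h1.trans_le hpq.1) h2)⟩
  le_antisymm p q hpq hqp := by
    obtain ⟨⟨β, f⟩, hp⟩ := p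
    obtain ⟨⟨γ, g⟩, hq⟩ := q
    have hβγ : β = γ := le_antisymm hpq.1 hqp.1
    subst hβγ
    have hfg : f = g := funext fun x => hpq.2 x.1 x.2 x.2
    subst hfg
    rfl

/-- `TreeEx` carries the coarse wedge topology. -/
instance : TopologicalSpace TreeEx := coarseWedge TreeEx


namespace TreeEx

/-- The length of a node of `TreeEx`. -/
def len (p : TreeEx) : Ordinal.{0} := p.1.1

open Classical in
/-- The value of a node at a coordinate, extended by `false` beyond its length. -/
noncomputable def val (p : TreeEx) (α : Ordinal.{0}) : Bool :=
  if h : α < p.len then p.1.2 ⟨α, h⟩ else false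

theorem val_of_lt {p : TreeEx} {α : Ordinal.{0}} (h : α < p.len) : p.val α = p.1.2 ⟨α, h⟩ :=
  dif_pos h

theorem len_le (p : TreeEx) : p.len ≤ omega1 + 1 := p.2.1

theorem le_iff {p q : TreeEx} :
    p ≤ q ↔ p.len ≤ q.len ∧ ∀ α < p.len, p.val α = q.val α := by
  refine and_congr_right fun hle => ⟨fun h α hα => ?_, fun h α h₁ h₂ => ?_⟩
  · rw [val_of_lt hα, val_of_lt (hα.trans_le hle)]
    exact h α hα (hα.trans_le hle)
  · have := h α h₁
    rwa [val_of_lt h₁, val_of_lt h₂] at this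

theorem eq_of_len_eq_of_val_eq {p q : TreeEx} (hlen : p.len = q.len)
    (hval : ∀ α < p.len, p.val α = q.val α) : p = q :=
  le_antisymm (le_iff.2 ⟨hlen.le, hval⟩)
    (le_iff.2 ⟨hlen.ge, fun α hα => (hval α (hlen ▸ hα)).symm⟩)

/-- The restriction of a node to the coordinates below `β`. -/
noncomputable def res (p : TreeEx) (β : Ordinal.{0}) : TreeEx :=
  ⟨⟨min β p.len, fun α => p.1.2 ⟨α.1, Set.mem_Iio.2 ((Set.mem_Iio.1 α.2).trans_le (min_le_right _ _))⟩⟩,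
    (min_le_right _ _).trans p.2.1, fun h => p.2.2 (h.trans_le (min_le_right _ _))⟩

theorem len_res {p : TreeEx} {β : Ordinal.{0}} (h : β ≤ p.len) : (p.res β).len = β :=
  min_eq_left h

theorem val_res {p : TreeEx} {β α : Ordinal.{0}} (h : β ≤ p.len) (hα : α < β) :
    (p.res β).val α = p.val α := by
  rw [val_of_lt (hα.trans_le (len_res h).ge), val_of_lt (hα.trans_le h)]
  rfl

theorem res_le {p : TreeEx} {β : Ordinal.{0}} (h : β ≤ p.len) : p.res β ≤ p :=
  le_iff.2 ⟨(len_res h).trans_le h, fun _ hα => val_res h (hα.trans_eq (len_res h))⟩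

theorem eq_res_of_le {p q : TreeEx} (h : q ≤ p) : q = p.res q.len := by
  rw [le_iff] at h
  exact eq_of_len_eq_of_val_eq (len_res h.1).symm fun α hα => by rw [val_res h.1 hα, h.2 α hα]

theorem len_lt_of_lt {p q : TreeEx} (h : p < q) : p.len < q.len := by
  refine (le_iff.1 h.le).1.lt_of_ne fun he => h.ne ?_
  exact eq_of_len_eq_of_val_eq he (le_iff.1 h.le).2

/-- The strict predecessors of a node correspond to the ordinals below its length. -/
noncomputable def predIso (p : TreeEx) :
    ((· < ·) : {q : TreeEx // q < p} → {q : TreeEx // q < p} → Prop) ≃r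
      ((· < ·) : Set.Iio p.len → Set.Iio p.len → Prop) where
  toFun q := ⟨q.1.len, len_lt_of_lt q.2⟩
  invFun β := ⟨p.res β, (res_le β.2.le).lt_of_ne fun h =>
    β.2.ne ((len_res β.2.le).symm.trans (congrArg len h))⟩
  left_inv q := Subtype.ext (eq_res_of_le q.2.le).symm
  right_inv β := Subtype.ext (len_res β.2.le)
  map_rel_iff' {q r} := by
    refine ⟨fun h => ?_, fun h => len_lt_of_lt h⟩
    have h : q.1.len < r.1.len := h
    have hq := le_iff.1 q.2.le
    have hr := le_iff.1 r.2.le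
    refine lt_of_le_of_ne (le_iff.2 ⟨h.le, fun α hα => ?_⟩) fun he => h.ne (by rw [he])
    rw [hq.2 α hα, hr.2 α (hα.trans h)]

theorem htx_eq (p : TreeEx) : htx p = Ordinal.lift.{1} p.len := by
  have hw : IsWellOrder {q : TreeEx // q < p} (· < ·) := p.predIso.toRelEmbedding.isWellOrder
  rw [htx, dif_pos hw, p.predIso.ordinalType_congr, type_Iio_lt, typein_ordinal]

theorem succLevel_of_len_eq {p : TreeEx} {β : Ordinal.{0}} (h : p.len = β + 1) : SuccLevel p :=
  ⟨Ordinal.lift.{1} β, by rw [htx_eq, h, Ordinal.lift_add, Ordinal.lift_one]⟩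

theorem isClopen_Vset {p : TreeEx} (h : SuccLevel p) : IsClopen (Vset p) :=
  ⟨⟨TopologicalSpace.isOpen_generateFrom_of_mem ⟨p, Or.inr h, Or.inr rfl⟩⟩,
    TopologicalSpace.isOpen_generateFrom_of_mem ⟨p, Or.inr h, Or.inl rfl⟩⟩

/-- The nodes on successor levels which lie below `p` or immediately above `p`. -/
def nearby (p : TreeEx) : Set TreeEx :=
  {s | SuccLevel s ∧ (s ≤ p ∨ p ≤ s ∧ s.len = p.len + 1)}

theorem exists_nearby_separating {p q : TreeEx} (hne : q ≠ p) :
    ∃ s ∈ p.nearby, ¬(s ≤ q ↔ s ≤ p) := by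
  by_cases hpq : p ≤ q
  · have hlt : p.len + 1 ≤ q.len := Order.add_one_le_of_lt (len_lt_of_lt (hpq.lt_of_ne hne.symm))
    have hp : ¬ q.res (p.len + 1) ≤ p := fun h => by
      have := (le_iff.1 h).1
      rw [len_res hlt] at this
      exact (Order.lt_add_one_iff.2 le_rfl).not_ge this
    refine ⟨q.res (p.len + 1), ⟨succLevel_of_len_eq (len_res hlt), Or.inr ⟨?_, len_res hlt⟩⟩,
      fun h => hp (h.1 (res_le hlt))⟩
    refine le_iff.2 ⟨(Order.le_succ _).trans (len_res hlt).ge, fun α hα => ?_⟩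
    rw [val_res hlt (hα.trans_le (Order.le_succ _)), (le_iff.1 hpq).2 α hα]
  · obtain ⟨α, hα, h⟩ : ∃ α < p.len, α < q.len → p.val α ≠ q.val α := by
      by_contra! hcon
      refine hpq (le_iff.2 ⟨?_, fun α hα => (hcon α hα).2⟩)
      by_contra! hlt
      exact (hcon _ hlt).1.false
    have hα' : α + 1 ≤ p.len := Order.add_one_le_of_lt hα
    have hlt : α < α + 1 := Order.lt_add_one_iff.2 le_rfl
    refine ⟨p.res (α + 1), ⟨succLevel_of_len_eq (len_res hα'), Or.inl (res_le hα')⟩, fun hiff => ?_⟩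
    have hq := le_iff.1 (hiff.2 (res_le hα'))
    rw [len_res hα'] at hq
    exact h (hlt.trans_le hq.1) ((val_res hα' hlt).symm.trans (hq.2 α hlt))

theorem mk_nearby_le (p : TreeEx) : #p.nearby ≤ ℵ₁ := by
  let e : p.nearby → Set.Iio (omega1 + 2) × Bool := fun s =>
    (⟨s.1.len, s.1.len_le.trans_lt (by
      rw [← one_add_one_eq_two, ← add_assoc]; exact Order.lt_add_one_iff.2 le_rfl)⟩,
      s.1.val p.len)
  have he : Function.Injective e := by
    rintro ⟨s, hsn, hs⟩ ⟨t, htn, ht⟩ hst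
    have hlen : s.len = t.len := congrArg (fun z => z.1.1) hst
    have hval : s.val p.len = t.val p.len := congrArg Prod.snd hst
    refine Subtype.ext (?_ : s = t)
    have hlt : p.len < p.len + 1 := Order.lt_add_one_iff.2 le_rfl
    rcases hs with hs | ⟨hs, hs'⟩ <;> rcases ht with ht | ⟨ht, ht'⟩
    · rw [eq_res_of_le hs, eq_res_of_le ht, hlen]
    · exact absurd ((le_iff.1 hs).1) (by rw [hlen, ht']; exact hlt.not_ge)
    · exact absurd ((le_iff.1 ht).1) (by rw [← hlen, hs']; exact hlt.not_ge)
    · refine eq_of_len_eq_of_val_eq hlen fun α hα => ?_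
      rw [hs', Order.lt_add_one_iff] at hα
      rcases hα.lt_or_eq with hα | rfl
      · rw [← (le_iff.1 hs).2 α hα, ← (le_iff.1 ht).2 α hα]
      · exact hval
  have hinf : ℵ₀ ≤ (ℵ₁ : Cardinal.{1}) := aleph0_le_aleph 1
  refine (mk_le_of_injective he).trans ?_
  rw [mk_prod, Cardinal.mk_Iio_ordinal]
  refine mul_le_of_le hinf ?_ ?_
  · have hc : (omega1 + 2).card ≤ ℵ₁ := by
      rw [card_add, omega1, card_ord]
      exact add_le_of_le (aleph0_le_aleph 1) le_rfl
        (by simpa using (natCast_lt_aleph0 (n := 2)).le.trans (aleph0_le_aleph 1))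
    simpa using Cardinal.lift_le.{1}.2 hc
  · simpa using (natCast_lt_aleph0 (n := 2)).le.trans hinf

end TreeEx

/-- If `U` is open in `[0, κ]` and contains `κ`, then it contains a tail of `[0, κ]`. -/
theorem exists_tail_subset_of_isOpen {κ : Ordinal.{0}} (hκ : 0 < κ) {U : Set (Set.Iic κ)}
    (hU : IsOpen[Preorder.topology _] U) (hmem : ⟨κ, Set.mem_Iic.2 le_rfl⟩ ∈ U) :
    ∃ α < κ, ∀ β : Set.Iic κ, α < β.1 → β ∈ U := by
  let _ := Preorder.topology (Set.Iic κ)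
  have : OrderTopology (Set.Iic κ) := ⟨rfl⟩
  have hlt : (⟨0, Set.mem_Iic.2 hκ.le⟩ : Set.Iic κ) < ⟨κ, Set.mem_Iic.2 le_rfl⟩ := hκ
  obtain ⟨a, ha, h⟩ := exists_Ioc_subset_of_mem_nhds (hU.mem_nhds hmem) ⟨_, hlt⟩
  exact ⟨a.1, ha, fun β hβ => h ⟨hβ, β.2⟩⟩

/-- There is no continuous injection of the ordinal space `[0, ω₂]` into `TreeEx`. -/
theorem TreeEx.not_injective_of_continuous {κ : Ordinal.{0}} (hκ : κ = (Cardinal.aleph 2).ord)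
    {f : Set.Iic κ → TreeEx} (hcont : @Continuous _ _ (Preorder.topology _) _ f) :
    ¬ Function.Injective f := by
  intro hinj
  have htwo : Order.succ ℵ₁ = (Cardinal.aleph 2 : Cardinal.{0}) := by
    rw [succ_aleph, one_add_one_eq_two]
  have hreg : (Cardinal.aleph 2 : Cardinal.{0}).IsRegular :=
    htwo ▸ isRegular_succ (aleph0_le_aleph 1)
  have hlim : Order.IsSuccLimit κ := hκ ▸ isSuccLimit_ord (aleph0_le_aleph 2)
  let top : Set.Iic κ := ⟨κ, Set.mem_Iic.2 le_rfl⟩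
  have htail : ∀ s : (f top).nearby, ∃ α < κ, ∀ β : Set.Iic κ, α < β.1 →
      (s.1 ≤ f β ↔ s.1 ≤ f top) := by
    rintro ⟨s, hs⟩
    have hcl := TreeEx.isClopen_Vset hs.1
    by_cases h : s ≤ f top
    · obtain ⟨α, hα, hsub⟩ := exists_tail_subset_of_isOpen hlim.bot_lt
        (@IsOpen.preimage _ _ (Preorder.topology _) _ f hcont _ hcl.isOpen) h
      exact ⟨α, hα, fun β hβ => iff_of_true (hsub β hβ) h⟩
    · obtain ⟨α, hα, hsub⟩ := exists_tail_subset_of_isOpen hlim.bot_lt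
        (@IsOpen.preimage _ _ (Preorder.topology _) _ f hcont _ hcl.compl.isOpen) h
      exact ⟨α, hα, fun β hβ => iff_of_false (hsub β hβ) h⟩
  choose α hα htail using htail
  have hcof : Cardinal.lift.{0} #(f top).nearby < (Ordinal.lift.{1} κ).cof := by
    rw [← lift_cof, hκ, hreg.cof_ord, ← htwo, Cardinal.lift_succ,
      Order.lt_succ_iff]
    simpa using (f top).mk_nearby_le
  have hsup : ⨆ s, α s < κ := lift_iSup_lt_of_lt_cof hcof hα
  have hbdd : BddAbove (Set.range α) := ⟨κ, by rintro _ ⟨s, rfl⟩; exact (hα s).le⟩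
  have hlt : (⨆ s, α s) + 1 < κ := hlim.add_one_lt hsup
  let γ : Set.Iic κ := ⟨(⨆ s, α s) + 1, hlt.le⟩
  have hγ : f γ ≠ f top := fun h =>
    hlt.ne (congrArg Subtype.val (hinj h))
  obtain ⟨s, hs, hsep⟩ := TreeEx.exists_nearby_separating hγ
  exact hsep (htail ⟨s, hs⟩ γ (Order.lt_add_one_iff.2 (le_ciSup hbdd ⟨s, hs⟩)))

theorem stmt17 :
    ¬ ∃ f : Set.Iic ((Cardinal.aleph 2).ord : Ordinal.{0}) → TreeEx,
      @Topology.IsEmbedding _ _ (Preorder.topology _) _ f := by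
  rintro ⟨f, hf⟩
  exact TreeEx.not_injective_of_continuous rfl
    (@Topology.IsEmbedding.continuous _ _ _ (Preorder.topology _) _ hf)
    (@Topology.IsEmbedding.injective _ _ (Preorder.topology _) _ _ hf)
end
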